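/- arXiv:1611.02211 — 16 statements merged into one kernel-verified Lean document; each statement's English description precedes it below -/
import Mathlib

section
/- If a commutative monoid M is s-noetherian, then the product monoid M × ℕ (where ℕ carries its additive monoid structure) is s-noetherian. -/
/-- An ideal of a commutative monoid `M`: a subset closed under multiplication
by arbitrary elements of `M`. -/
def IsMonoidIdeal (M : Type*) [CommMonoid M] (I : Set M) : Prop :=
  ∀ a ∈ I, ∀ m : M, a * m ∈ I

/-- A commutative monoid is s-noetherian if every ascending chain of ideals
is eventually constant. -/
def SNoetherian (M : Type*) [CommMonoid M] : Prop :=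
  ∀ I : ℕ → Set M, (∀ n, IsMonoidIdeal M (I n)) → (∀ n, I n ⊆ I (n + 1)) →
    ∃ N, ∀ n, N ≤ n → I n = I N

/-- A doubly indexed monotone family of ideals of an s-noetherian monoid stabilizes in the first
index, uniformly in the second. -/
theorem SNoetherian.exists_forall_eq_of_monotone {M : Type*} [CommMonoid M] (hM : SNoetherian M)
    (S : ℕ → ℕ → Set M) (hS : ∀ n k, IsMonoidIdeal M (S n k))
    (hmono : ∀ n n' k k', n ≤ n' → k ≤ k' → S n k ⊆ S n' k') :
    ∃ N, ∀ n, N ≤ n → ∀ k, S n k = S N k := by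
  obtain ⟨N, hN⟩ := hM (fun k => S k k) (fun k => hS k k)
    (fun k => hmono _ _ _ _ k.le_succ k.le_succ)
  choose f hf using fun k => hM (fun n => S n k) (fun n => hS n k)
    (fun n => hmono _ _ _ _ n.le_succ le_rfl)
  have diag : ∀ n k, N ≤ n → N ≤ k → S n k = S N N := fun n k hn hk =>
    ((hmono _ _ _ _ (le_max_left n k) (le_max_right n k)).trans
      (hN _ (hn.trans (le_max_left n k))).subset).antisymm (hmono _ _ _ _ hn hk)
  refine ⟨max N ((Finset.range N).sup f), fun n hn k => ?_⟩
  rcases le_or_gt N k with hk | hk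
  · rw [diag n k ((le_max_left _ _).trans hn) hk, diag _ k (le_max_left _ _) hk]
  · have hfk : f k ≤ max N ((Finset.range N).sup f) :=
      (Finset.le_sup (Finset.mem_range.2 hk)).trans (le_max_right _ _)
    exact (hf k n (hfk.trans hn)).trans (hf k _ hfk).symm

/-- If `M` is s-noetherian, then the product monoid `M × ℕ`
(with `ℕ` carrying its additive monoid structure) is s-noetherian. -/
theorem sNoetherian_prod_nat (M : Type*) [CommMonoid M] (hM : SNoetherian M) :
    SNoetherian (M × Multiplicative ℕ) := by
  intro I hI hsub
  obtain ⟨N, hN⟩ := hM.exists_forall_eq_of_monotone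
    (fun n k => {m | (m, Multiplicative.ofAdd k) ∈ I n})
    (fun n k a ha m => by simpa using hI n _ ha (m, 1))
    (fun n n' k k' hn hk m hm => by
      have h := hI n' _ (monotone_nat_of_le_succ hsub hn hm)
        (1, Multiplicative.ofAdd (k' - k))
      rwa [Prod.mk_mul_mk, mul_one, ← ofAdd_add, Nat.add_sub_cancel' hk] at h)
  refine ⟨N, fun n hn => Set.ext fun ⟨m, k⟩ => ?_⟩
  exact Set.ext_iff.1 (hN n hn k.toAdd) m
end

section
/- Every finitely generated commutative monoid is s-noetherian. -/
/-- In a finitely generated commutative monoid, divisibility is a well-quasi-order. -/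
theorem wellQuasiOrdered_dvd_of_closure_eq_top {M : Type*} [CommMonoid M] (S : Finset M)
    (hS : Submonoid.closure (S : Set M) = ⊤) : WellQuasiOrdered (fun a b : M => a ∣ b) := by
  intro x
  have hx : ∀ n, ∃ a : S → ℕ, x n = ∏ i : S, i.1 ^ a i := fun n =>
    Submonoid.mem_closure_finset'.mp (hS ▸ Submonoid.mem_top (x n))
  choose a ha using hx
  obtain ⟨m, n, hmn, hle⟩ := wellQuasiOrdered_le a
  refine ⟨m, n, hmn, ?_⟩
  simp only [ha]
  exact Finset.prod_dvd_prod_of_dvd _ _ fun i _ => pow_dvd_pow _ (hle i)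

/-- A commutative monoid whose divisibility relation is a well-quasi-order is s-noetherian. -/
theorem sNoetherian_of_wellQuasiOrdered_dvd {M : Type*} [CommMonoid M]
    (h : WellQuasiOrdered (fun a b : M => a ∣ b)) : SNoetherian M := by
  intro I hI hsucc
  have hmono : Monotone I := monotone_nat_of_le_succ hsucc
  by_contra! hne
  have hstep : ∀ N, ∃ n x, N ≤ n ∧ x ∈ I n ∧ x ∉ I N := fun N => by
    obtain ⟨n, hn, hnN⟩ := hne N
    obtain ⟨x, hx, hxN⟩ := Set.exists_of_ssubset ((hmono hn).ssubset_of_ne hnN.symm)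
    exact ⟨n, x, hn, hx, hxN⟩
  choose next x hle hmem hnotMem using hstep
  let k : ℕ → ℕ := fun j => next^[j] 0
  have hk : ∀ j, k (j + 1) = next (k j) := fun j => Function.iterate_succ_apply' next j 0
  have hkmono : Monotone k := monotone_nat_of_le_succ fun j => (hle (k j)).trans_eq (hk j).symm
  obtain ⟨i, j, hij, m, hm⟩ := h fun j => x (k j)
  apply hnotMem (k j)
  rw [hm]
  exact hmono ((hk i).symm.trans_le (hkmono hij)) (hI _ _ (hmem (k i)) m)

/-- Every finitely generated commutative monoid is s-noetherian. -/
theorem sNoetherian_of_fg (M : Type*) [CommMonoid M]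
    (hfg : ∃ S : Finset M, Submonoid.closure (S : Set M) = ⊤) :
    SNoetherian M := by
  obtain ⟨S, hS⟩ := hfg
  exact sNoetherian_of_wellQuasiOrdered_dvd (wellQuasiOrdered_dvd_of_closure_eq_top S hS)
end

section
/- Let M be an s-noetherian commutative monoid and S ⊆ M a submonoid. Then the localization S⁻¹M of M at S is s-noetherian. -/
theorem IsMonoidIdeal.preimage {M N : Type*} [CommMonoid M] [CommMonoid N] {I : Set N}
    (hI : IsMonoidIdeal N I) (f : M →* N) : IsMonoidIdeal M (f ⁻¹' I) := by
  intro a ha m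
  simpa only [Set.mem_preimage, map_mul] using hI _ ha (f m)

theorem IsMonoidIdeal.localization_mk_mem_iff {M : Type*} [CommMonoid M] {S : Submonoid M}
    {I : Set (Localization S)} (hI : IsMonoidIdeal (Localization S) I) (x : M) (s : S) :
    Localization.mk x s ∈ I ↔ Localization.mk x 1 ∈ I := by
  constructor <;> intro h
  · have h_mul := hI _ h (Localization.mk (s : M) 1)
    rw [Localization.mk_mul] at h_mul
    convert h_mul using 1
    exact Localization.mk_eq_mk_iff.2 (Localization.r_of_eq (by simp [mul_comm]))
  · simpa only [Localization.mk_mul, mul_one, one_mul] using hI _ h (Localization.mk 1 s)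

/-- If `M` is an s-noetherian commutative monoid and `S ⊆ M` a submonoid, then the
localization `S⁻¹M` is s-noetherian. -/
theorem sNoetherian_localization (M : Type*) [CommMonoid M] (hM : SNoetherian M)
    (S : Submonoid M) : SNoetherian (Localization S) := by
  intro I hI hmono
  let f : M →* Localization S := Localization.mkHom.comp (MonoidHom.inl M S)
  obtain ⟨N, hN⟩ := hM (fun n ↦ f ⁻¹' I n) (fun n ↦ (hI n).preimage f)
    (fun n ↦ Set.preimage_mono (hmono n))
  refine ⟨N, fun n hn ↦ Set.ext fun z ↦ ?_⟩
  induction z using Localization.induction_on with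
  | H y =>
    rw [(hI n).localization_mk_mem_iff, (hI N).localization_mk_mem_iff]
    exact Set.ext_iff.1 (hN n hn) y.1
end

section
/- Let M be an s-noetherian commutative monoid, A a finitely generated M-set, and B ⊆ A a subset closed under the action of M. Then B is a finitely generated M-set. -/
/-- A subset `B` of an `M`-set `A` is an `M`-subset if it is closed under the
action of `M`. -/
def IsMSubset (M : Type*) {A : Type*} [CommMonoid M] [MulAction M A] (B : Set A) : Prop :=
  ∀ a ∈ B, ∀ m : M, m • a ∈ B

/-- An `M`-set `A` is finitely generated if finitely many elements of `A`
generate it under the action of `M`. -/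
def MSetFG (M A : Type*) [CommMonoid M] [MulAction M A] : Prop :=
  ∃ s : Finset A, ∀ a : A, ∃ b ∈ s, ∃ m : M, a = m • b

/-- An `M`-subset `B` of an `M`-set `A` is finitely generated if finitely many
elements of `B` generate it under the action of `M`. -/
def MSubsetFG (M : Type*) {A : Type*} [CommMonoid M] [MulAction M A] (B : Set A) : Prop :=
  ∃ s : Finset A, (s : Set A) ⊆ B ∧ ∀ a ∈ B, ∃ b ∈ s, ∃ m : M, a = m • b

/-- Every subset `I` of an s-noetherian commutative monoid contains a finite set such that each
element of `I` is a multiple of one of its members. -/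
theorem SNoetherian.exists_finset_forall_dvd {M : Type*} [CommMonoid M] (hM : SNoetherian M)
    (I : Set M) :
    ∃ s : Finset M, (s : Set M) ⊆ I ∧ ∀ a ∈ I, ∃ b ∈ s, b ∣ a := by
  classical
  by_contra! h
  choose! f hfI hf using h
  obtain ⟨s, hs₀, hs⟩ : ∃ s : ℕ → Finset M, s 0 = ∅ ∧ ∀ n, s (n + 1) = insert (f (s n)) (s n) :=
    ⟨fun n ↦ Nat.rec ∅ (fun _ t ↦ insert (f t) t) n, rfl, fun _ ↦ rfl⟩
  have hsI (n : ℕ) : (s n : Set M) ⊆ I := by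
    induction n with
    | zero => simp [hs₀]
    | succ n ih =>
      rw [hs, Finset.coe_insert]
      exact Set.insert_subset (hfI _ ih) ih
  obtain ⟨N, hN⟩ := hM (fun n ↦ {a | ∃ b ∈ s n, b ∣ a})
    (fun n a ⟨b, hb, hba⟩ m ↦ ⟨b, hb, hba.mul_right m⟩)
    (fun n a ⟨b, hb, hba⟩ ↦ ⟨b, hs n ▸ Finset.mem_insert_of_mem hb, hba⟩)
  have hmem : f (s N) ∈ {a | ∃ b ∈ s (N + 1), b ∣ a} :=
    ⟨f (s N), hs N ▸ Finset.mem_insert_self _ _, dvd_rfl⟩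
  obtain ⟨b, hb, hba⟩ := (hN (N + 1) N.le_succ).subset hmem
  exact hf (s N) (hsI N) b hb hba

/-- Let `M` be an s-noetherian commutative monoid, `A` a finitely generated `M`-set
and `B ⊆ A` a subset closed under the action of `M`. Then `B` is a finitely
generated `M`-set. -/
theorem msubset_fg_of_fg (M A : Type*) [CommMonoid M] [MulAction M A]
    (hM : SNoetherian M) (hA : MSetFG M A) (B : Set A) (hB : IsMSubset M B) :
    MSubsetFG M B := by
  classical
  obtain ⟨s, hs⟩ := hA
  choose t htB ht using fun b ↦ hM.exists_finset_forall_dvd {m : M | m • b ∈ B}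
  refine ⟨s.biUnion fun b ↦ (t b).image (· • b), ?_, fun a ha ↦ ?_⟩
  · intro a ha
    simp only [Finset.coe_biUnion, Finset.coe_image, Set.mem_iUnion, Set.mem_image] at ha
    obtain ⟨b, -, m, hm, rfl⟩ := ha
    exact htB b hm
  · obtain ⟨b, hb, m, rfl⟩ := hs a
    obtain ⟨c, hc, d, rfl⟩ := ht b m ha
    exact ⟨c • b, Finset.mem_biUnion.2 ⟨b, hb, Finset.mem_image_of_mem _ hc⟩, d,
      by rw [mul_comm, mul_smul]⟩
end

section
/- Let M be an s-noetherian commutative monoid and A an M-set. Then A satisfies the ascending chain condition on M-subsets (every ascending sequence A₁ ⊆ A₂ ⊆ ⋯ of action-closed subsets of A is eventually constant) if and only if A is finitely generated. -/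
/-- An `M`-set satisfying the ascending chain condition on `M`-subsets is finitely generated. -/
theorem MSetFG.of_acc {M A : Type*} [CommMonoid M] [MulAction M A]
    (h : ∀ C : ℕ → Set A, (∀ n, IsMSubset M (C n)) → (∀ n, C n ⊆ C (n + 1)) →
      ∃ N, ∀ n, N ≤ n → C n = C N) : MSetFG M A := by
  by_contra hfg
  obtain ⟨f, -, hf⟩ := exists_seq_of_forall_finset_exists (fun _ : A => True)
    (fun x y => ∀ m : M, y ≠ m • x) (fun s _ => by
      by_contra hs
      refine hfg ⟨s, fun a => ?_⟩
      by_contra ha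
      exact hs ⟨a, trivial, fun x hx m hm => ha ⟨x, hx, m, hm⟩⟩)
  obtain ⟨N, hN⟩ := h (fun n => {a | ∃ i < n, ∃ m : M, a = m • f i})
    (by
      rintro n a ⟨i, hi, k, rfl⟩ m
      exact ⟨i, hi, m * k, (mul_smul m k (f i)).symm⟩)
    (by
      rintro n a ⟨i, hi, hm⟩
      exact ⟨i, hi.trans n.lt_succ_self, hm⟩)
  have hmem : f N ∈ {a | ∃ i < N + 1, ∃ m : M, a = m • f i} :=
    ⟨N, N.lt_succ_self, 1, (one_smul M (f N)).symm⟩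
  obtain ⟨i, hi, m, hm⟩ := (hN (N + 1) N.le_succ).subset hmem
  exact hf i N hi m hm

/-- A finitely generated `M`-set over an s-noetherian monoid satisfies the ascending chain
condition on `M`-subsets. -/
theorem MSetFG.acc {M A : Type*} [CommMonoid M] [MulAction M A] (hM : SNoetherian M)
    (hA : MSetFG M A) (C : ℕ → Set A) (hC : ∀ n, IsMSubset M (C n))
    (hmono : ∀ n, C n ⊆ C (n + 1)) : ∃ N, ∀ n, N ≤ n → C n = C N := by
  obtain ⟨s, hs⟩ := hA
  have hideal (b : A) : ∃ N, ∀ n, N ≤ n → {m : M | m • b ∈ C n} = {m : M | m • b ∈ C N} := by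
    refine hM (fun n => {m : M | m • b ∈ C n}) (fun n a ha m => ?_) (fun n _ ha => hmono n ha)
    simpa only [Set.mem_ofPred_eq, mul_comm a m, mul_smul] using hC n _ ha m
  choose N hN using hideal
  refine ⟨s.sup N, fun n hn => ?_⟩
  ext a
  obtain ⟨b, hb, m, rfl⟩ := hs a
  have hle : N b ≤ s.sup N := Finset.le_sup hb
  exact Set.ext_iff.mp ((hN b n (hle.trans hn)).trans (hN b _ hle).symm) m

/-- Let `M` be an s-noetherian commutative monoid and `A` an `M`-set. Then `A`
satisfies the ascending chain condition on `M`-subsets if and only if `A` is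
finitely generated. -/
theorem msets_acc_iff_fg (M A : Type*) [CommMonoid M] [MulAction M A]
    (hM : SNoetherian M) :
    (∀ C : ℕ → Set A, (∀ n, IsMSubset M (C n)) → (∀ n, C n ⊆ C (n + 1)) →
      ∃ N, ∀ n, N ≤ n → C n = C N) ↔ MSetFG M A :=
  ⟨MSetFG.of_acc, MSetFG.acc hM⟩
end

section
/- Let M be a commutative monoid and p a prime ideal of M. Then the localization M_p, regarded as an M-set via the canonical map M → M_p, is a filtered M-set. -/
/-- A prime ideal of a commutative monoid `M`: an ideal `p` with `1 ∉ p` such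
that `a * b ∈ p` implies `a ∈ p` or `b ∈ p`. -/
def IsPrimeMonoidIdeal (M : Type*) [CommMonoid M] (p : Set M) : Prop :=
  (1 : M) ∉ p ∧ (∀ a ∈ p, ∀ m : M, a * m ∈ p) ∧
    ∀ a b : M, a * b ∈ p → a ∈ p ∨ b ∈ p

/-- The complement of a prime ideal `p` of `M` is a submonoid of `M`. -/
def primeCompl (M : Type*) [CommMonoid M] (p : Set M) (h : IsPrimeMonoidIdeal M p) :
    Submonoid M where
  carrier := pᶜ
  one_mem' := h.1
  mul_mem' := by
    intro a b ha hb hab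
    rcases h.2.2 a b hab with h' | h'
    · exact ha h'
    · exact hb h'

/-- The action of `M` on the localization `S⁻¹M`, via the canonical
map `M → S⁻¹M`. -/
def locSMul {M : Type*} [CommMonoid M] {S : Submonoid M} (m : M)
    (x : Localization S) : Localization S :=
  Localization.mk m 1 * x

theorem locSMul_mk {M : Type*} [CommMonoid M] {S : Submonoid M} (m x : M) (s : S) :
    locSMul m (Localization.mk x s) = Localization.mk (m * x) s := by
  rw [locSMul, Localization.mk_mul, one_mul]

theorem exists_locSMul_eq_of_locSMul_eq {M : Type*} [CommMonoid M] {S : Submonoid M}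
    {m₁ m₂ : M} {a : Localization S} (h : locSMul m₁ a = locSMul m₂ a) :
    ∃ (m : M) (b : Localization S), locSMul m b = a ∧ m₁ * m = m₂ * m := by
  induction a using Localization.induction_on with
  | H y =>
    obtain ⟨x, s⟩ := y
    rw [locSMul_mk, locSMul_mk, Localization.mk_eq_mk_iff, Localization.r_iff_exists] at h
    obtain ⟨c, hc⟩ := h
    refine ⟨c * s * x, Localization.mk 1 (c * s * s), ?_, ?_⟩
    · rw [locSMul_mk, Localization.mk_eq_mk_iff]
      apply Localization.r_of_eq
      simp only [Submonoid.coe_mul, mul_one]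
      ac_rfl
    · calc m₁ * (c * s * x) = c * (s * (m₁ * x)) := by ac_rfl
        _ = c * (s * (m₂ * x)) := hc
        _ = m₂ * (c * s * x) := by ac_rfl

theorem exists_common_locSMul {M : Type*} [CommMonoid M] {S : Submonoid M}
    (a₁ a₂ : Localization S) :
    ∃ (m₁ m₂ : M) (a : Localization S), locSMul m₁ a = a₁ ∧ locSMul m₂ a = a₂ := by
  induction a₁, a₂ using Localization.induction_on₂ with
  | H y z =>
    obtain ⟨x, s⟩ := y
    obtain ⟨y, t⟩ := z
    refine ⟨x * t, y * s, Localization.mk 1 (s * t), ?_, ?_⟩ <;>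
    · rw [locSMul_mk, Localization.mk_eq_mk_iff]
      apply Localization.r_of_eq
      simp only [Submonoid.coe_mul, mul_one]
      ac_rfl

/-- Let `p` be a prime ideal of the commutative monoid `M`. The localization `M_p`,
regarded as an `M`-set via the canonical map `M → M_p`, is a filtered `M`-set. -/
theorem localization_at_prime_filtered (M : Type*) [CommMonoid M]
    (p : Set M) (hp : IsPrimeMonoidIdeal M p) :
    Nonempty (Localization (primeCompl M p hp)) ∧
    (∀ (m₁ m₂ : M) (a : Localization (primeCompl M p hp)),
      locSMul m₁ a = locSMul m₂ a →
      ∃ (m : M) (b : Localization (primeCompl M p hp)),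
        locSMul m b = a ∧ m₁ * m = m₂ * m) ∧
    (∀ a₁ a₂ : Localization (primeCompl M p hp),
      ∃ (m₁ m₂ : M) (a : Localization (primeCompl M p hp)),
        locSMul m₁ a = a₁ ∧ locSMul m₂ a = a₂) :=
  ⟨⟨1⟩, fun _ _ _ => exists_locSMul_eq_of_locSMul_eq, exists_common_locSMul⟩
end

section
/- Let M be a commutative monoid and A an M-set. Then the set p_A = { m ∈ M | the map l_m : A → A, a ↦ m • a, is not bijective } is a prime ideal of M; that is, 1 ∉ p_A, if m ∈ p_A and x ∈ M then m*x ∈ p_A, and if m*n ∈ p_A then m ∈ p_A or n ∈ p_A. -/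
/-- For an `M`-set `A`, the set of elements `m : M` for which the translation
map `l_m : A → A`, `a ↦ m • a`, is not bijective. -/
def nonBijSet (M A : Type*) [CommMonoid M] [MulAction M A] : Set M :=
  {m : M | ¬ Function.Bijective (fun a : A => m • a)}

/-- Let `M` be a commutative monoid and `A` an `M`-set. The set
`p_A = { m | l_m : A → A is not bijective }` is a prime ideal of `M`: `1 ∉ p_A`,
`p_A` is closed under multiplication by arbitrary elements, and
`m * n ∈ p_A` implies `m ∈ p_A` or `n ∈ p_A`. -/
theorem nonBijSet_isPrimeIdeal (M A : Type*) [CommMonoid M] [MulAction M A] :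
    (1 : M) ∉ nonBijSet M A ∧
    (∀ m ∈ nonBijSet M A, ∀ x : M, m * x ∈ nonBijSet M A) ∧
    (∀ m n : M, m * n ∈ nonBijSet M A → m ∈ nonBijSet M A ∨ n ∈ nonBijSet M A) := by
  have smul_mul_eq (m n : M) :
      (fun a : A => (m * n) • a) = (fun a : A => m • a) ∘ (fun a : A => n • a) :=
    funext fun a => mul_smul m n a
  refine ⟨?_, ?_, ?_⟩
  · refine not_not_intro ?_
    simpa only [one_smul] using! Function.bijective_id
  · intro m hm x h
    refine hm ⟨?_, ?_⟩
    · have hx := h.injective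
      rw [mul_comm, smul_mul_eq] at hx
      exact hx.of_comp
    · have hx := h.surjective
      rw [smul_mul_eq] at hx
      exact hx.of_comp
  · intro m n h
    by_contra! hc
    refine h ?_
    rw [smul_mul_eq]
    exact (not_not.mp hc.1).comp (not_not.mp hc.2)
end

section
/- Let M be a commutative monoid and p a prime ideal of M. For m ∈ M, the map l_m : M_p → M_p, x ↦ m • x, is bijective if and only if m ∉ p. In other words, p_{M_p} = { m ∈ M | l_m : M_p → M_p is not bijective } equals p. -/
/-- Let `p` be a prime ideal of the commutative monoid `M`. For `m : M`, the map
`l_m : M_p → M_p`, `x ↦ m • x`, is bijective if and only if `m ∉ p`;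
that is, `p_{M_p} = p`. -/
theorem prime_of_localization (M : Type*) [CommMonoid M]
    (p : Set M) (hp : IsPrimeMonoidIdeal M p) (m : M) :
    Function.Bijective (fun x : Localization (primeCompl M p hp) => locSMul m x) ↔
      m ∉ p := by
  refine ⟨fun h hm => ?_, fun hm => ?_⟩
  · obtain ⟨x, hx⟩ := h.2 1
    induction x using Localization.induction_on with
    | H y =>
      obtain ⟨a, b⟩ := y
      change Localization.mk m 1 * Localization.mk a b = 1 at hx
      rw [Localization.mk_mul, ← Localization.mk_one, Localization.mk_eq_mk_iff,
        Localization.r_iff_exists] at hx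
      obtain ⟨c, hc⟩ := hx
      simp only [OneMemClass.coe_one, one_mul, mul_one] at hc
      refine (c * b).2 ?_
      rw [Submonoid.coe_mul, ← hc, mul_left_comm]
      exact hp.2.1 m hm _
  · have hu : Localization.mk m (1 : primeCompl M p hp) * Localization.mk 1 ⟨m, hm⟩ = 1 := by
      rw [Localization.mk_mul, mul_one, one_mul]
      exact Localization.mk_self ⟨m, hm⟩
    exact IsUnit.isUnit_iff_mulLeft_bijective.mp (IsUnit.of_mul_eq_one _ hu)
end

section
/- Let M be a commutative monoid, A a filtered M-set, and m ∈ M. If the map l_m : A → A, a ↦ m • a, is surjective, then it is injective (hence bijective). -/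
/-- An `M`-set `A` is filtered: it is nonempty; whenever `m₁ • a = m₂ • a` there
are `m`, `b` with `m • b = a` and `m₁ * m = m₂ * m`; and any two elements are
generated by a common element. -/
def IsFilteredMSet (M A : Type*) [CommMonoid M] [MulAction M A] : Prop :=
  Nonempty A ∧
  (∀ (m₁ m₂ : M) (a : A), m₁ • a = m₂ • a →
    ∃ (m : M) (b : A), m • b = a ∧ m₁ * m = m₂ * m) ∧
  (∀ a₁ a₂ : A, ∃ (m₁ m₂ : M) (a : A), m₁ • a = a₁ ∧ m₂ • a = a₂)

/-- Let `M` be a commutative monoid, `A` a filtered `M`-set and `m ∈ M`. If the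
map `l_m : A → A`, `a ↦ m • a`, is surjective, then it is injective. -/
theorem filtered_surjective_imp_injective (M A : Type*) [CommMonoid M] [MulAction M A]
    (hA : IsFilteredMSet M A) (m : M)
    (hsurj : Function.Surjective (fun a : A => m • a)) :
    Function.Injective (fun a : A => m • a) := by
  obtain ⟨-, hF2, hF3⟩ := hA
  intro a₁ a₂ h
  obtain ⟨p, q, c, rfl, rfl⟩ := hF3 a₁ a₂
  obtain ⟨n, b, rfl, hn⟩ := hF2 (m * p) (m * q) c (by simpa only [mul_smul] using h)
  obtain ⟨d, rfl⟩ := hsurj b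
  have key (r : M) : r • n • m • d = (m * r * n) • d := by
    simp only [← mul_smul, mul_comm, mul_left_comm]
  simp only [key, hn]
end

section
/- Let M be a commutative monoid and A a filtered and conservative M-set. If a ∈ A is a source of A, then the map λ_a : M → A, m ↦ m • a, is bijective. -/
/-- An `M`-set `A` is conservative if bijectivity of `l_m : A → A` implies that
`m` is invertible in `M`. -/
def IsConservativeMSet (M A : Type*) [CommMonoid M] [MulAction M A] : Prop :=
  ∀ m : M, Function.Bijective (fun a : A => m • a) → IsUnit m

/-- An element `a` of an `M`-set `A` is a source if whenever `a = m • b`,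
the map `l_m : A → A` is bijective. -/
def IsSource (M : Type*) {A : Type*} [CommMonoid M] [MulAction M A] (a : A) : Prop :=
  ∀ (m : M) (b : A), a = m • b → Function.Bijective (fun x : A => m • x)

/-- Let `M` be a commutative monoid and `A` a filtered and conservative `M`-set.
If `a ∈ A` is a source of `A`, then `λ_a : M → A`, `m ↦ m • a`, is bijective. -/
theorem source_orbit_bijective (M A : Type*) [CommMonoid M] [MulAction M A]
    (hfil : IsFilteredMSet M A) (hcons : IsConservativeMSet M A)
    (a : A) (hsrc : IsSource M a) :
    Function.Bijective (fun m : M => m • a) := by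
  obtain ⟨-, heq, hgen⟩ := hfil
  constructor
  · intro m₁ m₂ h
    obtain ⟨m, b, hb, hm⟩ := heq m₁ m₂ a h
    exact (hcons m (hsrc m b hb.symm)).mul_right_cancel hm
  · intro x
    obtain ⟨m₁, m₂, c, h₁, h₂⟩ := hgen a x
    obtain ⟨u, rfl⟩ := hcons m₁ (hsrc m₁ c h₁.symm)
    refine ⟨m₂ * ↑u⁻¹, ?_⟩
    simp only [← h₁, ← h₂, smul_smul, mul_assoc, Units.inv_mul, mul_one]
end

section
/- Let M be a commutative monoid and p a prime ideal of M. If M_p is conservative as an M-set, then every element of M∖p is invertible in M, and the canonical map M → M_p is bijective. -/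
theorem Localization.isUnit_mk_one {M : Type*} [CommMonoid M] {S : Submonoid M} (s : S) :
    IsUnit (Localization.mk (s : M) 1 : Localization S) :=
  (Localization.monoidOf S).map_units s

/-- Let `p` be a prime ideal of the commutative monoid `M`. If `M_p` is
conservative as an `M`-set, then every element of `M∖p` is invertible in `M`
and the canonical map `M → M_p` is bijective. -/
theorem conservative_localization (M : Type*) [CommMonoid M]
    (p : Set M) (hp : IsPrimeMonoidIdeal M p)
    (hcons : ∀ m : M,
      Function.Bijective (fun x : Localization (primeCompl M p hp) => locSMul m x) →
        IsUnit m) :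
    (∀ s : M, s ∉ p → IsUnit s) ∧
    Function.Bijective
      (fun m : M => (Localization.mk m 1 : Localization (primeCompl M p hp))) := by
  have units : ∀ s : M, s ∉ p → IsUnit s := fun s hs ↦
    hcons s <| (Localization.isUnit_mk_one ⟨s, hs⟩).unit.mulLeft_bijective
  refine ⟨units, fun a b hab ↦ ?_, fun x ↦ ?_⟩
  · obtain ⟨c, hc⟩ := Localization.r_iff_exists.mp (Localization.mk_eq_mk_iff.mp hab)
    exact (units c c.2).mul_left_cancel (by simpa using hc)
  · induction x using Localization.induction_on with
    | H y =>
      obtain ⟨a, s⟩ := y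
      obtain ⟨u, hu⟩ := units s s.2
      refine ⟨↑u⁻¹ * a, ?_⟩
      simp [Localization.mk_eq_mk_iff, Localization.r_iff_exists, ← hu]
end

section
/- Let M be an almost finitely generated commutative monoid and A a filtered and conservative M-set. Then there exists an element a ∈ A such that the map λ_a : M → A, m ↦ m • a, is bijective. -/
/-- A commutative monoid `M` is almost finitely generated if there are finitely
many non-invertible elements `e₁, …, e_k` such that every `m : M` can be written
as `m = g * e₁ ^ α₁ * ⋯ * e_k ^ α_k` with `g` invertible. -/
def AlmostFG (M : Type*) [CommMonoid M] : Prop :=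
  ∃ (k : ℕ) (e : Fin k → M), (∀ i, ¬ IsUnit (e i)) ∧
    ∀ m : M, ∃ (g : M) (α : Fin k → ℕ), IsUnit g ∧ m = g * ∏ i, e i ^ α i

namespace IsFilteredMSet

variable {M A : Type*} [CommMonoid M] [MulAction M A]

/-- On a filtered `M`-set, an element that acts surjectively acts injectively. -/
theorem injective_smul_of_surjective (h : IsFilteredMSet M A) {m : M}
    (hm : Function.Surjective (fun a : A => m • a)) :
    Function.Injective (fun a : A => m • a) := by
  intro x y hxy
  obtain ⟨p, q, c, rfl, rfl⟩ := h.2.2 x y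
  simp only [smul_smul] at hxy
  obtain ⟨n, d, rfl, hn⟩ := h.2.1 _ _ _ hxy
  obtain ⟨d, rfl⟩ := hm d
  have hpq : p * (n * m) = q * (n * m) := by
    calc p * (n * m) = m * p * n := by ac_rfl
      _ = m * q * n := hn
      _ = q * (n * m) := by ac_rfl
  simp only [smul_smul, hpq]

/-- Finitely many elements of a filtered `M`-set lie in a common orbit. -/
theorem exists_forall_smul_eq (h : IsFilteredMSet M A) {ι : Type*} (s : Finset ι) (f : ι → A) :
    ∃ a : A, ∀ i ∈ s, ∃ m : M, m • a = f i := by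
  classical
  induction s using Finset.induction_on with
  | empty => exact h.1.elim fun a => ⟨a, by simp⟩
  | insert i s _ ih =>
    obtain ⟨a, ha⟩ := ih
    obtain ⟨m₁, m₂, b, rfl, hb⟩ := h.2.2 a (f i)
    refine ⟨b, fun j hj => ?_⟩
    rcases Finset.mem_insert.mp hj with rfl | hj
    · exact ⟨m₂, hb⟩
    · obtain ⟨m, hm⟩ := ha j hj
      exact ⟨m * m₁, by rw [mul_smul, hm]⟩

/-- An element of a filtered `M`-set that is divisible only by units is a free generator. -/
theorem bijective_smul_of_forall_isUnit (h : IsFilteredMSet M A) {a : A}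
    (ha : ∀ (m : M) (b : A), m • b = a → IsUnit m) :
    Function.Bijective (fun m : M => m • a) := by
  constructor
  · intro m₁ m₂ hm
    obtain ⟨m, b, hb, hm⟩ := h.2.1 m₁ m₂ a hm
    exact (ha m b hb).mul_right_cancel hm
  · intro b
    obtain ⟨m₁, m₂, c, hc, rfl⟩ := h.2.2 a b
    obtain ⟨u, rfl⟩ := ha m₁ c hc
    refine ⟨m₂ * ↑u⁻¹, ?_⟩
    simp only [← hc, smul_smul, mul_assoc, Units.inv_mul, mul_one]

end IsFilteredMSet

/-- Let `M` be an almost finitely generated commutative monoid and `A` a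
filtered and conservative `M`-set. Then there exists `a ∈ A` such that
`λ_a : M → A`, `m ↦ m • a`, is bijective. -/
theorem filtered_conservative_free (M A : Type*) [CommMonoid M] [MulAction M A]
    (hM : AlmostFG M) (hfil : IsFilteredMSet M A) (hcons : IsConservativeMSet M A) :
    ∃ a : A, Function.Bijective (fun m : M => m • a) := by
  obtain ⟨k, e, he, hgen⟩ := hM
  have hns : ∀ i, ∃ a : A, ∀ b : A, e i • b ≠ a := fun i => by
    by_contra! hsurj
    exact he i (hcons (e i) ⟨hfil.injective_smul_of_surjective hsurj, hsurj⟩)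
  choose f hf using hns
  obtain ⟨a, ha⟩ := hfil.exists_forall_smul_eq Finset.univ f
  refine ⟨a, hfil.bijective_smul_of_forall_isUnit fun m b hb => ?_⟩
  obtain ⟨g, α, hg, rfl⟩ := hgen m
  suffices hα : ∀ i, α i = 0 by simpa [hα] using hg
  intro i
  by_contra hi
  obtain ⟨c, hc⟩ : e i ∣ g * ∏ j, e j ^ α j :=
    ((dvd_pow_self (e i) hi).trans
      (Finset.dvd_prod_of_mem (fun j => e j ^ α j) (Finset.mem_univ i))).mul_left g
  obtain ⟨n, hn⟩ := ha i (Finset.mem_univ i)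
  refine hf i ((n * c) • b) ?_
  rw [← hn, ← hb, hc, smul_smul, smul_smul, mul_left_comm]
end

section
/- Let M be an almost finitely generated commutative monoid and A a filtered M-set. Then there exists a prime ideal p of M and a bijection φ : M_p → A satisfying φ(m • x) = m • φ(x) for all m ∈ M and x ∈ M_p; moreover, the prime ideal p is uniquely determined by A. -/
open Function in
theorem IsFilteredMSet.injective_of_surjective {M A : Type*} [CommMonoid M] [MulAction M A]
    (hA : IsFilteredMSet M A) {m : M} (hm : Surjective (m • · : A → A)) :
    Injective (m • · : A → A) := by
  intro a₁ a₂ h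
  obtain ⟨m₁, m₂, a, rfl, rfl⟩ := hA.2.2 a₁ a₂
  simp only [← mul_smul] at h
  obtain ⟨n, b, rfl, hn⟩ := hA.2.1 _ _ _ h
  obtain ⟨c, rfl⟩ := hm b
  simp only [← mul_smul]
  rw [show m₁ * (n * m) = m * m₁ * n by ac_rfl, hn]
  congr 1
  ac_rfl

theorem surjective_smul_mul_iff {M : Type*} (A : Type*) [CommMonoid M] [MulAction M A]
    {m n : M} : Function.Surjective ((m * n) • · : A → A) ↔
      Function.Surjective (m • · : A → A) ∧ Function.Surjective (n • · : A → A) := by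
  refine ⟨fun h => ⟨fun a => ?_, fun a => ?_⟩, fun ⟨hm, hn⟩ a => ?_⟩
  · obtain ⟨b, rfl⟩ := h a
    exact ⟨n • b, (mul_smul m n b).symm⟩
  · obtain ⟨b, rfl⟩ := h a
    exact ⟨m • b, by simp only [← mul_smul, mul_comm]⟩
  · obtain ⟨b, rfl⟩ := hm a
    obtain ⟨c, rfl⟩ := hn b
    exact ⟨c, mul_smul m n c⟩

theorem isPrimeMonoidIdeal_not_surjective (M A : Type*) [CommMonoid M] [MulAction M A] :
    IsPrimeMonoidIdeal M {m | ¬ Function.Surjective (m • · : A → A)} := by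
  refine ⟨fun h => h fun a => ⟨a, one_smul M a⟩, fun a ha m h => ?_, fun a b h => ?_⟩
  · exact ha ((surjective_smul_mul_iff A).1 h).1
  · by_contra! hab
    exact h ((surjective_smul_mul_iff A).2 ⟨not_not.1 hab.1, not_not.1 hab.2⟩)

theorem mem_primeCompl {M : Type*} [CommMonoid M] {p : Set M} {hp : IsPrimeMonoidIdeal M p}
    {m : M} : m ∈ primeCompl M p hp ↔ m ∉ p :=
  Iff.rfl

theorem surjective_locSMul_iff {M : Type*} [CommMonoid M] {p : Set M}
    {hp : IsPrimeMonoidIdeal M p} {m : M} :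
    Function.Surjective (locSMul m : Localization (primeCompl M p hp) → _) ↔ m ∉ p := by
  refine ⟨fun h hm => ?_, fun hm x => ⟨Localization.mk 1 ⟨m, hm⟩ * x, ?_⟩⟩
  · obtain ⟨x, hx⟩ := h 1
    induction x using Localization.induction_on with | _ y
    rw [locSMul, Localization.mk_mul, ← Localization.mk_one, Localization.mk_eq_mk_iff,
      Localization.r_iff_exists] at hx
    obtain ⟨c, hc⟩ := hx
    have hs := (c * y.2).2
    rw [mem_primeCompl] at hs
    refine hs ?_
    have : ((c * y.2 : primeCompl M p hp) : M) = m * (y.1 * c) := by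
      simp only [OneMemClass.coe_one, one_mul, mul_one] at hc
      rw [Submonoid.coe_mul, ← hc]
      ac_rfl
    rw [this]
    exact hp.2.1 m hm _
  · rw [locSMul, ← mul_assoc, Localization.mk_mul, mul_one, one_mul,
      Localization.mk_self ⟨m, hm⟩, one_mul]

/-- Finitely many elements of a filtered `M`-set are all multiples of a common element. -/
theorem IsFilteredMSet.exists_forall_smul_eq_s15 {M A ι : Type*} [CommMonoid M] [MulAction M A]
    (hA : IsFilteredMSet M A) (s : Finset ι) (f : ι → A) :
    ∃ a : A, ∀ i ∈ s, ∃ m : M, m • a = f i := by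
  classical
  induction s using Finset.induction_on with
  | empty => exact ⟨hA.1.some, by simp⟩
  | insert j s _ ih =>
    obtain ⟨a, ha⟩ := ih
    obtain ⟨m₁, m₂, b, rfl, hb⟩ := hA.2.2 a (f j)
    refine ⟨b, fun i hi => ?_⟩
    obtain rfl | hi := Finset.mem_insert.1 hi
    · exact ⟨m₂, hb⟩
    · obtain ⟨m, hm⟩ := ha i hi
      exact ⟨m * m₁, by rw [mul_smul, hm]⟩

/-- A filtered `M`-set over an almost finitely generated monoid has an element which is
divisible only by those elements of `M` that act surjectively. -/
theorem IsFilteredMSet.exists_surjective_of_smul_eq {M A : Type*} [CommMonoid M] [MulAction M A]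
    (hM : AlmostFG M) (hA : IsFilteredMSet M A) :
    ∃ a : A, ∀ (m : M) (b : A), m • b = a → Function.Surjective (m • · : A → A) := by
  obtain ⟨k, e, -, he⟩ := hM
  have hf : ∀ i, ∃ a : A, (∃ b, e i • b = a) → Function.Surjective (e i • · : A → A) := by
    intro i
    by_contra! h
    obtain ⟨_, hn⟩ := h hA.1.some
    exact hn fun a => (h a).1
  choose f hf using hf
  obtain ⟨a, ha⟩ := hA.exists_forall_smul_eq_s15 Finset.univ f
  have hdvd : ∀ (i : Fin k) (n : M) (b : A), (e i * n) • b = a →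
      Function.Surjective (e i • · : A → A) := by
    rintro i n b rfl
    obtain ⟨m, hm⟩ := ha i (Finset.mem_univ i)
    refine hf i ⟨m • n • b, ?_⟩
    rw [← hm]
    simp only [← mul_smul]
    congr 1
    ac_rfl
  refine ⟨a, fun m b hb => ?_⟩
  obtain ⟨g, α, hg, rfl⟩ := he m
  have hp := isPrimeMonoidIdeal_not_surjective M A
  have hg' : g ∈ primeCompl M _ hp := by
    obtain ⟨u, rfl⟩ := hg
    exact not_not.2 (MulAction.surjective u)
  refine not_not.1 (mul_mem hg' (prod_mem fun i _ => ?_) : _ ∈ primeCompl M _ hp)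
  rcases Nat.eq_zero_or_pos (α i) with h0 | hpos
  · simp [h0]
  · refine pow_mem (not_not.2 ?_ : e i ∈ primeCompl M _ hp) _
    obtain ⟨n, hn⟩ := ((dvd_pow_self (e i) hpos.ne').trans
      (Finset.dvd_prod_of_mem (fun j => e j ^ α j) (Finset.mem_univ i))).mul_left g
    exact hdvd i n b (hn ▸ hb)

/-- Let `M` be an almost finitely generated commutative monoid and `A` a filtered
`M`-set. Then there is a prime ideal `p` of `M` and an `M`-equivariant bijection
`M_p → A`; moreover the prime ideal `p` is uniquely determined by `A`. -/
theorem filtered_iso_localization (M A : Type*) [CommMonoid M] [MulAction M A]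
    (hM : AlmostFG M) (hA : IsFilteredMSet M A) :
    ∃ (p : Set M) (hp : IsPrimeMonoidIdeal M p),
      (∃ φ : Localization (primeCompl M p hp) → A,
        Function.Bijective φ ∧
        ∀ (m : M) (x : Localization (primeCompl M p hp)),
          φ (locSMul m x) = m • φ x) ∧
      ∀ (q : Set M) (hq : IsPrimeMonoidIdeal M q),
        (∃ ψ : Localization (primeCompl M q hq) → A,
          Function.Bijective ψ ∧
          ∀ (m : M) (x : Localization (primeCompl M q hq)),
            ψ (locSMul m x) = m • ψ x) → q = p := by
  have hp := isPrimeMonoidIdeal_not_surjective M A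
  refine ⟨_, hp, ?_, ?_⟩
  · obtain ⟨a, ha⟩ := hA.exists_surjective_of_smul_eq hM
    set S := primeCompl M _ hp
    have hsurj (s : S) : Function.Surjective ((s : M) • · : A → A) := not_not.1 s.2
    have hinj (s : S) : Function.Injective ((s : M) • · : A → A) :=
      hA.injective_of_surjective (hsurj s)
    have hex : ∀ x : Localization S, ∃ b : A, ∀ (m : M) (s : S),
        x = Localization.mk m s → (s : M) • b = m • a := by
      intro x
      induction x using Localization.induction_on with | _ y
      obtain ⟨m, s⟩ := y
      obtain ⟨b, hb⟩ := hsurj s (m • a)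
      refine ⟨b, fun m' s' h => ?_⟩
      rw [Localization.mk_eq_mk_iff, Localization.r_iff_exists] at h
      obtain ⟨c, hc⟩ := h
      refine hinj (c * s) ?_
      change ((c : M) * s) • _ = ((c : M) * s) • _
      replace hb : (s : M) • b = m • a := hb
      calc ((c : M) * s) • (s' : M) • b = ((c : M) * s') • (s : M) • b := by
            simp only [← mul_smul]
            congr 1
            ac_rfl
        _ = ((c : M) * (s' * m)) • a := by rw [hb, ← mul_smul, mul_assoc]
        _ = ((c : M) * s) • m' • a := by rw [hc, ← mul_smul, mul_assoc]
    choose φ hφ using hex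
    refine ⟨φ, ⟨fun x y hxy => ?_, fun b => ?_⟩, fun m x => ?_⟩
    · induction x using Localization.induction_on with | _ x
      induction y using Localization.induction_on with | _ y
      have hx := hφ _ x.1 x.2 rfl
      have hy := hφ _ y.1 y.2 rfl
      rw [hxy] at hx
      obtain ⟨n, b, hb, hn⟩ := hA.2.1 ((y.2 : M) * x.1) (x.2 * y.1) a (by
        rw [mul_smul, mul_smul, ← hx, ← hy, smul_comm])
      rw [Localization.mk_eq_mk_iff, Localization.r_iff_exists]
      refine ⟨⟨n, not_not.2 (ha n b hb)⟩, ?_⟩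
      rw [mul_comm, hn, mul_comm]
    · obtain ⟨n, m, c, hn, rfl⟩ := hA.2.2 a b
      let s : S := ⟨n, not_not.2 (ha n c hn)⟩
      refine ⟨Localization.mk m s, hinj s ?_⟩
      change (s : M) • _ = n • m • c
      rw [hφ _ m s rfl, ← hn, smul_comm]
    · induction x using Localization.induction_on with | _ x
      have h := hφ (locSMul m (Localization.mk x.1 x.2)) (m * x.1) x.2 (by
        rw [locSMul, Localization.mk_mul, one_mul])
      refine hinj x.2 ?_
      change (x.2 : M) • _ = (x.2 : M) • m • _
      rw [h, smul_comm, hφ _ x.1 x.2 rfl, mul_smul]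
  · rintro q hq ⟨ψ, hψ, hψm⟩
    ext m
    have h : ψ ∘ locSMul m = (m • · : A → A) ∘ ψ := funext (hψm m)
    rw [Set.mem_ofPred_eq, ← not_iff_not, not_not, ← surjective_locSMul_iff (hp := hq),
      ← hψ.surjective.of_comp_iff, ← h, Function.Surjective.of_comp_iff' hψ]
end

section
/- Let P be a type, M = P →₀ ℕ the free commutative monoid on P acting by translation on P →₀ ℤ, and let f, g : P → WithBot ℤ be functions such that the sets {p | ¬ f p ≤ 0} and {p | ¬ g p ≤ 0} are finite. If there exists a map ψ : A(f) → A(g) satisfying ψ(m + x) = m + ψ(x) for all m ∈ M and x ∈ A(f) (where m is coerced into P →₀ ℤ), then: for every p ∈ P, f p = ⊥ implies g p = ⊥, and the set {p | ¬ g p ≤ f p} is finite. -/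
/-- The canonical embedding of the free commutative monoid `P →₀ ℕ` into its
Grothendieck group `P →₀ ℤ`. -/
noncomputable def natToInt {P : Type*} (m : P →₀ ℕ) : P →₀ ℤ :=
  Finsupp.mapRange (fun n : ℕ => (n : ℤ)) (by simp) m

/-- For `f : P → WithBot ℤ`, the set
`A(f) = { x : P →₀ ℤ | ∀ p, f p ≤ x p }`. -/
def Af {P : Type*} (f : P → WithBot ℤ) : Set (P →₀ ℤ) :=
  {x : P →₀ ℤ | ∀ p : P, f p ≤ ((x p : ℤ) : WithBot ℤ)}

theorem natToInt_mapRange_toNat {P : Type*} {z : P →₀ ℤ} (hz : 0 ≤ z) :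
    natToInt (z.mapRange Int.toNat rfl) = z := by
  ext p
  simpa [natToInt] using hz p

theorem Af_nonempty {P : Type*} {f : P → WithBot ℤ} (hf : {p : P | ¬ f p ≤ 0}.Finite) :
    (Af f).Nonempty := by
  classical
  refine ⟨Finsupp.onFinset hf.toFinset (fun p => if f p ≤ 0 then 0 else (f p).unbotD 0) ?_, ?_⟩
  · intro p hp
    simp only [Set.Finite.mem_toFinset, Set.mem_ofPred_eq]
    intro h
    simp [h] at hp
  · intro p
    rw [Finsupp.onFinset_apply]
    split_ifs with h
    · exact h
    · cases hfp : f p <;> simp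

theorem update_mem_Af {P : Type*} {f : P → WithBot ℤ} {x : P →₀ ℤ} (hx : x ∈ Af f) {p : P} {n : ℤ}
    (hn : f p ≤ n) : x.update p n ∈ Af f := by
  classical
  intro q
  rw [Finsupp.update_apply]
  split_ifs with h
  · exact h ▸ hn
  · exact hx q

/-- An equivariant map out of `A(f)` is a translation. -/
theorem sub_eq_sub_of_equivariant {P : Type*} {f : P → WithBot ℤ} {ψ : (P →₀ ℤ) → (P →₀ ℤ)}
    (hequiv : ∀ (m : P →₀ ℕ), ∀ x ∈ Af f, ψ (natToInt m + x) = natToInt m + ψ x)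
    {x y : P →₀ ℤ} (hx : x ∈ Af f) (hy : y ∈ Af f) : ψ x - x = ψ y - y := by
  have sub_eq_of_le : ∀ {u v : P →₀ ℤ}, u ∈ Af f → u ≤ v → ψ v - v = ψ u - u := by
    intro u v hu huv
    have h := hequiv ((v - u).mapRange Int.toNat rfl) u hu
    rw [natToInt_mapRange_toNat (z := v - u) (fun p => by simpa using huv p),
      sub_add_cancel] at h
    rw [h]
    abel
  exact (sub_eq_of_le hx le_sup_left).symm.trans (sub_eq_of_le hy (le_sup_right (a := x)))

/-- Let `f, g : P → WithBot ℤ` take positive values only finitely often, and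
suppose there is a map `ψ : A(f) → A(g)` equivariant for the translation action
of the free commutative monoid `P →₀ ℕ`. Then `f p = ⊥` implies `g p = ⊥` for
every `p`, and `f p ≥ g p` for all but finitely many `p`. -/
theorem hom_of_Af_constraints {P : Type*} (f g : P → WithBot ℤ)
    (hf : {p : P | ¬ f p ≤ 0}.Finite) (hg : {p : P | ¬ g p ≤ 0}.Finite)
    (ψ : (P →₀ ℤ) → (P →₀ ℤ))
    (hmaps : ∀ x ∈ Af f, ψ x ∈ Af g)
    (hequiv : ∀ (m : P →₀ ℕ), ∀ x ∈ Af f, ψ (natToInt m + x) = natToInt m + ψ x) :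
    (∀ p : P, f p = ⊥ → g p = ⊥) ∧ {p : P | ¬ g p ≤ f p}.Finite := by
  obtain ⟨x₀, hx₀⟩ := Af_nonempty hf
  set d := ψ x₀ - x₀ with hd
  have le_add : ∀ (p : P) (n : ℤ), f p ≤ n → g p ≤ ((n + d p : ℤ) : WithBot ℤ) := by
    classical
    intro p n hn
    have hx := update_mem_Af hx₀ hn
    have hψ : ψ (x₀.update p n) = x₀.update p n + d := by
      rw [hd, sub_eq_sub_of_equivariant hequiv hx₀ hx]
      abel
    simpa [hψ, Finsupp.update_apply] using hmaps _ hx p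
  have eq_bot : ∀ p : P, f p = ⊥ → g p = ⊥ := by
    intro p hp
    refine WithBot.eq_bot_iff_forall_lt.2 fun n => ?_
    have h := le_add p (n - 1 - d p) (by simp [hp])
    exact h.trans_lt (WithBot.coe_lt_coe.2 (by lia))
  refine ⟨eq_bot, d.support.finite_toSet.subset fun p hp => ?_⟩
  rw [Finset.mem_coe, Finsupp.mem_support_iff]
  intro hdp
  refine hp ?_
  cases hfp : f p with
  | bot => exact (eq_bot p hfp).le
  | coe n => simpa [hdp] using le_add p n hfp.le
end

section
/- Let M be a cancellative commutative monoid, A a filtered M-set, and a, b ∈ A. If the orbits { m • a | m ∈ M } and { m • b | m ∈ M } are equal, then there exists an invertible element u ∈ M such that a = u • b. -/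
/-- Let `M` be a cancellative commutative monoid, `A` a filtered `M`-set, and
`a, b ∈ A`. If the orbits `M • a` and `M • b` coincide, then `a = u • b` for
some invertible `u ∈ M`. -/
theorem eq_orbits_unit (M A : Type*) [CancelCommMonoid M] [MulAction M A]
    (hfil : IsFilteredMSet M A) (a b : A)
    (horb : {x : A | ∃ m : M, x = m • a} = {x : A | ∃ m : M, x = m • b}) :
    ∃ u : M, IsUnit u ∧ a = u • b := by
  obtain ⟨m, hm⟩ : a ∈ {x : A | ∃ m : M, x = m • b} := horb ▸ ⟨1, (one_smul M a).symm⟩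
  obtain ⟨n, hn⟩ : b ∈ {x : A | ∃ m : M, x = m • a} := horb ▸ ⟨1, (one_smul M b).symm⟩
  have hstab : (m * n) • a = (1 : M) • a := by rw [mul_smul, ← hn, ← hm, one_smul]
  obtain ⟨k, -, -, hk⟩ := hfil.2.1 _ _ _ hstab
  exact ⟨m, IsUnit.of_mul_eq_one n (mul_right_cancel hk), hm⟩
end

section
/- Let P be a type and M = P →₀ ℕ the free commutative monoid on P acting by translation on P →₀ ℤ. Let A ⊆ P →₀ ℤ be a subset that is closed under the translation action of M and is a filtered M-set. Then there exists a function f : P → WithBot ℤ such that the set {p | ¬ f p ≤ 0} is finite and A = A(f), i.e. A = { x : P →₀ ℤ | ∀ p, f p ≤ (x p : WithBot ℤ) }. -/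
/-- A subset of `P →₀ ℤ` is closed under the translation action of the free
commutative monoid `P →₀ ℕ`. -/
def IsTranslationClosed {P : Type*} (A : Set (P →₀ ℤ)) : Prop :=
  ∀ m : P →₀ ℕ, ∀ x ∈ A, natToInt m + x ∈ A

/-- A translation-closed subset `A ⊆ P →₀ ℤ` is a filtered `(P →₀ ℕ)`-set. -/
def IsFilteredTranslationSet {P : Type*} (A : Set (P →₀ ℤ)) : Prop :=
  A.Nonempty ∧
  (∀ m₁ m₂ : P →₀ ℕ, ∀ a ∈ A, natToInt m₁ + a = natToInt m₂ + a →
    ∃ m : P →₀ ℕ, ∃ b ∈ A, natToInt m + b = a ∧ m₁ + m = m₂ + m) ∧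
  (∀ a₁ ∈ A, ∀ a₂ ∈ A, ∃ m₁ m₂ : P →₀ ℕ, ∃ a ∈ A,
    natToInt m₁ + a = a₁ ∧ natToInt m₂ + a = a₂)

theorem natToInt_apply {P : Type*} (m : P →₀ ℕ) (p : P) : natToInt m p = (m p : ℤ) := by
  simp [natToInt]

theorem le_of_natToInt_add_eq {P : Type*} {m : P →₀ ℕ} {a x : P →₀ ℤ}
    (h : natToInt m + a = x) : a ≤ x := by
  intro p
  rw [← h, Finsupp.add_apply, natToInt_apply]
  lia

theorem IsTranslationClosed.isUpperSet {P : Type*} {A : Set (P →₀ ℤ)}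
    (hA : IsTranslationClosed A) : IsUpperSet A := by
  intro a x hax ha
  have hx : natToInt ((x - a).mapRange Int.toNat Int.toNat_zero) + a = x := by
    ext p
    have := hax p
    simp only [Finsupp.add_apply, natToInt_apply, Finsupp.mapRange_apply, Finsupp.sub_apply]
    lia
  exact hx ▸ hA _ a ha

theorem IsFilteredTranslationSet.exists_le_le {P : Type*} {A : Set (P →₀ ℤ)}
    (hA : IsFilteredTranslationSet A) {a₁ a₂ : P →₀ ℤ} (h₁ : a₁ ∈ A) (h₂ : a₂ ∈ A) :
    ∃ a ∈ A, a ≤ a₁ ∧ a ≤ a₂ := by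
  obtain ⟨m₁, m₂, a, ha, e₁, e₂⟩ := hA.2.2 a₁ h₁ a₂ h₂
  exact ⟨a, ha, le_of_natToInt_add_eq e₁, le_of_natToInt_add_eq e₂⟩

/-- A nonempty set of integers has an infimum in `WithBot ℤ`, which is `⊥` or attained. -/
theorem exists_withBot_le_coe_iff {S : Set ℤ} (hS : S.Nonempty) :
    ∃ b : WithBot ℤ, ∀ n : ℤ, b ≤ (n : WithBot ℤ) ↔ ∃ s ∈ S, s ≤ n := by
  by_cases hb : BddBelow S
  · obtain ⟨c, hc⟩ := hb
    obtain ⟨l, hl, hmin⟩ := Int.exists_least_of_bdd (P := (· ∈ S)) ⟨c, fun _ hz => hc hz⟩ hS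
    refine ⟨l, fun n => ?_⟩
    rw [WithBot.coe_le_coe]
    exact ⟨fun h => ⟨l, hl, h⟩, fun ⟨s, hs, hsn⟩ => (hmin s hs).trans hsn⟩
  · refine ⟨⊥, fun n => iff_of_true bot_le ?_⟩
    obtain ⟨s, hs, hsn⟩ := not_bddBelow_iff.mp hb n
    exact ⟨s, hs, hsn.le⟩

/-- In a filtered set, finitely many coordinates can be lowered simultaneously. -/
theorem IsFilteredTranslationSet.exists_le_forall_mem_le {P : Type*} {A : Set (P →₀ ℤ)}
    (hA : IsFilteredTranslationSet A) {a₀ : P →₀ ℤ} (h₀ : a₀ ∈ A) {x : P → ℤ}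
    (hx : ∀ p, ∃ a ∈ A, a p ≤ x p) (T : Finset P) :
    ∃ a ∈ A, a ≤ a₀ ∧ ∀ p ∈ T, a p ≤ x p := by
  classical
  induction T using Finset.induction_on with
  | empty => exact ⟨a₀, h₀, le_rfl, by simp⟩
  | insert q T _ ih =>
    obtain ⟨b, hb, hb₀, hbT⟩ := ih
    obtain ⟨c, hc, hcq⟩ := hx q
    obtain ⟨a, ha, hab, hac⟩ := hA.exists_le_le hb hc
    refine ⟨a, ha, hab.trans hb₀, fun p hp => ?_⟩
    rcases Finset.mem_insert.mp hp with rfl | hp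
    · exact (hac p).trans hcq
    · exact (hab p).trans (hbT p hp)

/-- Every translation-closed subset `A ⊆ P →₀ ℤ` which is a filtered
`(P →₀ ℕ)`-set is of the form `A(f)` for some `f : P → WithBot ℤ` taking
positive values only finitely often. -/
theorem filtered_eq_Af {P : Type*} (A : Set (P →₀ ℤ))
    (hclosed : IsTranslationClosed A) (hfil : IsFilteredTranslationSet A) :
    ∃ f : P → WithBot ℤ, {p : P | ¬ f p ≤ 0}.Finite ∧ A = Af f := by
  classical
  obtain ⟨a₀, h₀⟩ := hfil.1
  choose f hf using fun p : P =>
    exists_withBot_le_coe_iff (S := (fun a : P →₀ ℤ => a p) '' A) ⟨a₀ p, a₀, h₀, rfl⟩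
  simp only [Set.exists_mem_image] at hf
  refine ⟨f, a₀.support.finite_toSet.subset fun p hp => ?_, Set.ext fun x => ?_⟩
  · rw [Finset.mem_coe, Finsupp.mem_support_iff]
    exact fun hp0 => hp ((hf p 0).2 ⟨a₀, h₀, hp0.le⟩)
  · refine ⟨fun hx p => (hf p (x p)).2 ⟨x, hx, le_rfl⟩, fun hx => ?_⟩
    obtain ⟨a, ha, haa₀, hax⟩ := hfil.exists_le_forall_mem_le h₀
      (fun p => (hf p (x p)).1 (hx p)) (a₀.support ∪ x.support)
    refine hclosed.isUpperSet (fun p => ?_) ha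
    by_cases hp : p ∈ a₀.support ∪ x.support
    · exact hax p hp
    · simp only [Finset.mem_union, Finsupp.mem_support_iff, not_or, not_not] at hp
      rw [hp.2, ← hp.1]
      exact haa₀ p
end
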